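/- In the free noncommutative unital algebra over ℤ/2 on generators a₁, x₂, b₁, b₂ modulo the two-sided ideal generated by the relations 1 + (1 + b₂b₁)a₁ and 1 + a₁(1 + b₂b₁), every element that has a right inverse also has a left inverse. -/

import Mathlib

open FreeAlgebra

/-- The free noncommutative unital algebra over ℤ/2 on generators a₁, x₂, b₁, b₂. -/
abbrev F0 : Type := FreeAlgebra (ZMod 2) (Fin 4)

noncomputable def a₁ : F0 := ι (ZMod 2) 0
noncomputable def x₂ : F0 := ι (ZMod 2) 1
noncomputable def b₁ : F0 := ι (ZMod 2) 2
noncomputable def b₂ : F0 := ι (ZMod 2) 3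

/-- The relations 1 + (1 + b₂b₁)a₁ = 0 and 1 + a₁(1 + b₂b₁) = 0. -/
inductive Rel0 : F0 → F0 → Prop
  | r1 : Rel0 (1 + (1 + b₂ * b₁) * a₁) 0
  | r2 : Rel0 (1 + a₁ * (1 + b₂ * b₁)) 0

/-- The quotient of the free algebra by the two-sided ideal generated by the relations. -/
abbrev R0 : Type := RingQuot Rel0

/-- The action of an element of a free algebra on a finite-dimensional space of vectors only depends
on the action of the generators on some larger finite-dimensional space. -/
theorem FreeAlgebra.exists_fg_intertwine {K R X : Type*} [Field K] [Ring R] [Algebra K R]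
    (y : X → R) (f : FreeAlgebra K X) (A : Submodule K R) (hA : A.FG) :
    ∃ B : Submodule K R, B.FG ∧ ∀ (V : Type) [AddCommGroup V] [Module K V]
      (g : X → Module.End K V) (j : R →ₗ[K] V),
      (∀ i, ∀ w ∈ B, g i (j w) = j (y i * w)) →
      ∀ w ∈ A, lift K g f (j w) = j (lift K y f * w) := by
  induction f using FreeAlgebra.induction generalizing A with
  | grade0 r =>
    refine ⟨⊥, Submodule.fg_bot, fun V _ _ g j _ w _ ↦ ?_⟩
    simp [Module.algebraMap_end_apply, ← Algebra.smul_def]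
  | grade1 i =>
    refine ⟨A, hA, fun V _ _ g j h w hw ↦ ?_⟩
    simpa using h i w hw
  | mul p q hp hq =>
    obtain ⟨B, hB, hBq⟩ := hq A hA
    obtain ⟨C, hC, hCp⟩ := hp (A.map (LinearMap.mulLeft K (lift K y q))) (hA.map _)
    refine ⟨B ⊔ C, hB.sup hC, fun V _ _ g j h w hw ↦ ?_⟩
    have h₁ := hBq V g j (fun i w hw ↦ h i w (Submodule.mem_sup_left hw)) w hw
    have h₂ := hCp V g j (fun i w hw ↦ h i w (Submodule.mem_sup_right hw))
      (lift K y q * w) (Submodule.mem_map.2 ⟨w, hw, rfl⟩)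
    rw [map_mul (lift K g), map_mul (lift K y), Module.End.mul_apply, h₁, h₂, mul_assoc]
  | add p q hp hq =>
    obtain ⟨B, hB, hBq⟩ := hq A hA
    obtain ⟨C, hC, hCp⟩ := hp A hA
    refine ⟨B ⊔ C, hB.sup hC, fun V _ _ g j h w hw ↦ ?_⟩
    have h₁ := hBq V g j (fun i w hw ↦ h i w (Submodule.mem_sup_left hw)) w hw
    have h₂ := hCp V g j (fun i w hw ↦ h i w (Submodule.mem_sup_right hw)) w hw
    rw [map_add (lift K g), map_add (lift K y), LinearMap.add_apply, h₁, h₂, add_mul, map_add]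

/-- Left multiplication by a unit, restricted to a subspace, extends to an automorphism of any
finite-dimensional space containing the image. -/
theorem Submodule.exists_linearEquiv_eq_mul {K R : Type*} [Field K] [Ring R] [Algebra K R]
    (t : Rˣ) (U W : Submodule K R) [FiniteDimensional K W] (htU : ∀ w ∈ U, (t : R) * w ∈ W) :
    ∃ τ : W ≃ₗ[K] W, ∀ w : W, (w : R) ∈ U → (τ w : R) = t * w := by
  let f : U.comap W.subtype →ₗ[K] W :=
    ((LinearMap.mulLeft K (t : R)) ∘ₗ W.subtype ∘ₗ (U.comap W.subtype).subtype).codRestrict W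
      fun w ↦ htU _ w.2
  have hf : Function.Injective f := fun v w h ↦ by
    have h' : (t : R) * (v : W) = t * (w : W) := congrArg Subtype.val h
    exact Subtype.ext (Subtype.ext ((Units.mul_right_inj t).1 h'))
  obtain ⟨τ, hτ⟩ := Submodule.exists_linearEquiv_restrict_eq (LinearEquiv.ofInjective f hf)
  exact ⟨τ, fun w hw ↦ (congrArg Subtype.val (hτ ⟨w, hw⟩)).symm⟩

/-- If `b * c = t - 1` with `t` a unit of an algebra, then the left multiplications by
`b`, `c`, `t⁻¹` and any `x`, restricted to a finite-dimensional subspace, are induced by operators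
on a finite-dimensional space satisfying the same relations. -/
theorem exists_finiteDimensional_model {K : Type*} {R : Type} [Field K] [Ring R] [Algebra K R]
    (t : Rˣ) (b c x : R) (hbc : b * c = t - 1) (B : Submodule K R) (hB : B.FG) :
    ∃ (V : Type) (_ : AddCommGroup V) (_ : Module K V) (_ : FiniteDimensional K V)
      (τ : (Module.End K V)ˣ) (b' c' x' : Module.End K V) (j : R →ₗ[K] V),
      b' * c' = τ - 1 ∧ (∀ w ∈ B, j w = 0 → w = 0) ∧ ∀ w ∈ B,
        (↑τ⁻¹ : Module.End K V) (j w) = j (↑t⁻¹ * w) ∧ b' (j w) = j (b * w) ∧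
        c' (j w) = j (c * w) ∧ x' (j w) = j (x * w) := by
  let U : Submodule K R := B ⊔ B.map (LinearMap.mulLeft K (↑t⁻¹ : R))
  let W : Submodule K R :=
    U ⊔ (U.map (LinearMap.mulLeft K c) ⊔ U.map (LinearMap.mulLeft K (t : R)))
  have hUfg : U.FG := hB.sup (hB.map _)
  have hWfg : W.FG := hUfg.sup ((hUfg.map _).sup (hUfg.map _))
  have hBU : B ≤ U := le_sup_left
  have hUW : U ≤ W := le_sup_left
  have htB : ∀ w ∈ B, (↑t⁻¹ : R) * w ∈ U := fun w hw ↦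
    Submodule.mem_sup_right (Submodule.mem_map.2 ⟨w, hw, rfl⟩)
  have hcU : ∀ w ∈ U, c * w ∈ W := fun w hw ↦
    Submodule.mem_sup_right (Submodule.mem_sup_left (Submodule.mem_map.2 ⟨w, hw, rfl⟩))
  have htU : ∀ w ∈ U, (t : R) * w ∈ W := fun w hw ↦
    Submodule.mem_sup_right (Submodule.mem_sup_right (Submodule.mem_map.2 ⟨w, hw, rfl⟩))
  have : FiniteDimensional K W := Module.Finite.iff_fg.2 hWfg
  obtain ⟨τ, hτ⟩ := Submodule.exists_linearEquiv_eq_mul t U W htU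
  obtain ⟨P, hP⟩ := LinearMap.exists_extend (LinearMap.id : W →ₗ[K] W)
  obtain ⟨Q, hQ⟩ := LinearMap.exists_extend (LinearMap.id : U →ₗ[K] U)
  replace hP : ∀ w : W, P w = w := fun w ↦ LinearMap.congr_fun hP w
  replace hQ : ∀ w : U, Q w = w := fun w ↦ LinearMap.congr_fun hQ w
  let q : W →ₗ[K] W := Submodule.inclusion hUW ∘ₗ Q ∘ₗ W.subtype
  let β : W →ₗ[K] W := P ∘ₗ LinearMap.mulLeft K b ∘ₗ W.subtype
  let γ : W →ₗ[K] W := P ∘ₗ LinearMap.mulLeft K c ∘ₗ W.subtype ∘ₗ q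
  let ξ : W →ₗ[K] W := P ∘ₗ LinearMap.mulLeft K x ∘ₗ W.subtype
  have hq : ∀ w : W, (w : R) ∈ U → q w = w := fun w hw ↦
    Subtype.ext (congrArg (Subtype.val : U → R) (hQ ⟨w, hw⟩))
  have hqU : ∀ w : W, (q w : R) ∈ U := fun w ↦ (Q w).2
  have hβγ : ∀ w : W, β (γ w) = τ (q w) - q w := fun w ↦ by
    have h₁ : (γ w : R) = c * q w := congrArg Subtype.val (hP ⟨_, hcU _ (hqU w)⟩)
    have h₂ : b * (c * (q w : R)) = ((τ (q w) - q w : W) : R) := by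
      rw [← mul_assoc, hbc, sub_mul, one_mul, Submodule.coe_sub, hτ _ (hqU w)]
    change P (b * (γ w : R)) = _
    rw [h₁, h₂, hP]
  let T : (W × W) ≃ₗ[K] (W × W) := τ.prodCongr (LinearEquiv.refl K W)
  let τ' : (Module.End K (W × W))ˣ := LinearMap.GeneralLinearGroup.ofLinearEquiv T
  refine ⟨W × W, inferInstance, inferInstance, inferInstance, τ',
    LinearMap.inl K W W ∘ₗ (β.coprod (τ.toLinearMap - LinearMap.id)),
    γ.prod (LinearMap.id - q) ∘ₗ LinearMap.fst K W W,
    LinearMap.inl K W W ∘ₗ ξ ∘ₗ LinearMap.fst K W W, LinearMap.inl K W W ∘ₗ P, ?_, ?_, ?_⟩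
  · refine LinearMap.ext fun ⟨v, w⟩ ↦ Prod.ext ?_ ?_
    · change β (γ v) + (τ (v - q v) - (v - q v)) = τ v - v
      rw [hβγ, map_sub]
      abel
    · change (0 : W) = w - w
      rw [sub_self]
  · intro w hw h
    have h₁ : P w = 0 := congrArg Prod.fst h
    have h₂ := hP ⟨w, hUW (hBU hw)⟩
    exact congrArg Subtype.val (h₂.symm.trans h₁)
  · intro w hw
    have hPw : P w = ⟨w, hUW (hBU hw)⟩ := hP ⟨w, hUW (hBU hw)⟩
    refine ⟨?_, ?_, ?_, ?_⟩
    · have h₁ : P (↑t⁻¹ * w) = ⟨↑t⁻¹ * w, hUW (htB w hw)⟩ := hP ⟨_, hUW (htB w hw)⟩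
      have h₂ : τ (P (↑t⁻¹ * w)) = P w := by
        rw [h₁, hPw]
        exact Subtype.ext ((hτ _ (htB w hw)).trans (Units.mul_inv_cancel_left t w))
      change T.symm (P w, 0) = (P (↑t⁻¹ * w), 0)
      rw [LinearEquiv.symm_apply_eq]
      exact Prod.ext h₂.symm rfl
    · refine Prod.ext ?_ rfl
      change P (b * (P w : R)) + (τ 0 - 0) = P (b * w)
      rw [hPw, map_zero, sub_zero, add_zero]
    · have h : q (P w) = P w := hq _ (by rw [hPw]; exact hBU hw)
      refine Prod.ext ?_ ?_
      · change P (c * (q (P w) : R)) = P (c * w)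
        rw [h, hPw]
      · change P w - q (P w) = 0
        rw [h, sub_self]
    · refine Prod.ext ?_ rfl
      change P (x * (P w : R)) = P (x * w)
      rw [hPw]

theorem one_add_one_eq_zero_of_algebra_zmod_two (S : Type*) [Ring S] [Algebra (ZMod 2) S] :
    (1 : S) + 1 = 0 := by
  have h := congrArg (algebraMap (ZMod 2) S) (by decide : (1 : ZMod 2) + 1 = 0)
  rwa [map_add, map_one, map_zero] at h

/-- In R0, every element with a right inverse has a left inverse. -/
theorem stmt0 (u : R0) (h : ∃ v : R0, u * v = 1) : ∃ w : R0, w * u = 1 := by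
  obtain ⟨v, huv⟩ := h
  refine ⟨v, sub_eq_zero.1 ?_⟩
  let π : F0 →ₐ[ZMod 2] R0 := RingQuot.mkAlgHom (ZMod 2) Rel0
  have hlift : lift (ZMod 2) (fun i ↦ π (ι (ZMod 2) i)) = π := FreeAlgebra.hom_ext (by ext; simp)
  have eq_of_one_add {S : Type} [Ring S] [Algebra (ZMod 2) S] {s : S} (hs : 1 + s = 0) :
      s = 1 := by
    exact add_left_cancel (hs.trans (one_add_one_eq_zero_of_algebra_zmod_two S).symm)
  have h₁ : (1 + π b₂ * π b₁) * π a₁ = 1 := eq_of_one_add <| by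
    simpa using RingQuot.mkAlgHom_rel (ZMod 2) Rel0.r1
  have h₂ : π a₁ * (1 + π b₂ * π b₁) = 1 := eq_of_one_add <| by
    simpa using RingQuot.mkAlgHom_rel (ZMod 2) Rel0.r2
  let t : R0ˣ := ⟨_, _, h₁, h₂⟩
  obtain ⟨f, hf⟩ := RingQuot.mkAlgHom_surjective (ZMod 2) Rel0 (v * u - 1)
  obtain ⟨B, hB, hBf⟩ := FreeAlgebra.exists_fg_intertwine (fun i ↦ π (ι (ZMod 2) i)) f
    (Submodule.span (ZMod 2) {1}) (Submodule.fg_span_singleton 1)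
  obtain ⟨V, _, _, _, τ, b', c', x', j, hrel, hj, hact⟩ := exists_finiteDimensional_model
    (K := ZMod 2) t (π b₂) (π b₁) (π x₂) (add_sub_cancel_left _ _).symm
    (B ⊔ Submodule.span (ZMod 2) {v * u - 1}) (hB.sup (Submodule.fg_span_singleton _))
  let g : Fin 4 → Module.End (ZMod 2) V := ![↑τ⁻¹, x', c', b']
  have hg : ∀ i, ∀ w ∈ B, g i (j w) = j (π (ι (ZMod 2) i) * w) := fun i w hw ↦ by
    obtain ⟨ha, hb, hc, hx⟩ := hact w (Submodule.mem_sup_left hw)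
    fin_cases i
    exacts [ha, hx, hc, hb]
  have hτ : 1 + b' * c' = τ := by rw [hrel, add_sub_cancel]
  have two := one_add_one_eq_zero_of_algebra_zmod_two (Module.End (ZMod 2) V)
  have hresp : ∀ ⦃p q : F0⦄, Rel0 p q → lift (ZMod 2) g p = lift (ZMod 2) g q := by
    rintro _ _ (_ | _)
    all_goals simpa [a₁, b₁, b₂, g, hτ] using two
  let ρ : R0 →ₐ[ZMod 2] Module.End (ZMod 2) V :=
    RingQuot.liftAlgHom (ZMod 2) ⟨lift (ZMod 2) g, hresp⟩
  have hρ : ρ (v * u - 1) = 0 := by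
    rw [map_sub, map_mul, map_one, sub_eq_zero]
    exact mul_eq_one_comm.1 (by rw [← map_mul, huv, map_one])
  have hρf : lift (ZMod 2) g f = 0 := by
    rw [← hρ, ← hf]
    exact (RingQuot.liftAlgHom_mkAlgHom_apply (ZMod 2) _ hresp f).symm
  have key := hBf V g j hg 1 (Submodule.mem_span_singleton_self 1)
  rw [hρf, hlift, mul_one, show π f = v * u - 1 from hf] at key
  exact hj _ (Submodule.mem_sup_right (Submodule.mem_span_singleton_self _)) key.symm
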